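/- Suppose x̄ is a 𝔷-uniform Slater point and g satisfies the exponential growth condition at x̄. Then the probability function Φ is continuously differentiable on an open neighborhood U' of x̄, and for all x ∈ U', ∇Φ(x) = ∫_{S^{m−1} × 𝒞} ∇_x e_c(x, v) d(ζ ⊗ 𝔪)(v, c). -/

import Mathlib

open MeasureTheory Real Set
open scoped InnerProductSpace ENNReal

noncomputable section

/-- The density of the chi distribution with `m` degrees of freedom. -/
def chiPDF (m : ℕ) (r : ℝ) : ℝ :=
  (2 ^ (1 - (m : ℝ) / 2) / Real.Gamma ((m : ℝ) / 2)) * r ^ (m - 1) * Real.exp (-r ^ 2 / 2)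

/-- Matrix applied to a Euclidean vector. -/
def mApp {m : ℕ} (A : Matrix (Fin m) (Fin m) ℝ) (v : EuclideanSpace ℝ (Fin m)) :
    EuclideanSpace ℝ (Fin m) :=
  Matrix.toEuclideanLin A v

/-- The set `{r ≥ 0 : g(x, r·𝔏(c)v + 𝔷(c)) ≤ 0}`. -/
def radialSet {n m p : ℕ} (g : EuclideanSpace ℝ (Fin n) → EuclideanSpace ℝ (Fin m) → ℝ)
    (z : EuclideanSpace ℝ (Fin p) → EuclideanSpace ℝ (Fin m))
    (L : EuclideanSpace ℝ (Fin p) → Matrix (Fin m) (Fin m) ℝ)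
    (c : EuclideanSpace ℝ (Fin p)) (x : EuclideanSpace ℝ (Fin n))
    (v : EuclideanSpace ℝ (Fin m)) : Set ℝ :=
  {r : ℝ | 0 ≤ r ∧ g x (r • mApp (L c) v + z c) ≤ 0}

/-- The parametric radial probability function `e_c(x, v)`. -/
def radialE {n m p : ℕ} (g : EuclideanSpace ℝ (Fin n) → EuclideanSpace ℝ (Fin m) → ℝ)
    (z : EuclideanSpace ℝ (Fin p) → EuclideanSpace ℝ (Fin m))
    (L : EuclideanSpace ℝ (Fin p) → Matrix (Fin m) (Fin m) ℝ)
    (c : EuclideanSpace ℝ (Fin p)) (x : EuclideanSpace ℝ (Fin n))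
    (v : EuclideanSpace ℝ (Fin m)) : ℝ :=
  ∫ r in radialSet g z L c x v, chiPDF m r

/-- The uniform (normalized rotation-invariant) probability measure on the
unit sphere `S^{m-1}`, obtained by normalizing the surface measure induced by
the Lebesgue measure. -/
def unifSphere (m : ℕ) : Measure (Metric.sphere (0 : EuclideanSpace ℝ (Fin m)) 1) :=
  (((volume : Measure (EuclideanSpace ℝ (Fin m))).toSphere) Set.univ)⁻¹ •
    ((volume : Measure (EuclideanSpace ℝ (Fin m))).toSphere)


lemma aux_chi_cont (m : ℕ) : Continuous (chiPDF m) := by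
  unfold chiPDF
  fun_prop

lemma aux_chi_nonneg (m : ℕ) (r : ℝ) (hr : 0 ≤ r) : 0 ≤ chiPDF m r := by
  unfold chiPDF
  have : 0 ≤ Real.Gamma ((m : ℝ) / 2) := Real.Gamma_nonneg_of_nonneg (by positivity)
  positivity

lemma aux_chi_bound (m : ℕ) (l : ℝ) :
    ∃ K > 0, ∀ r, 0 ≤ r → chiPDF m r ≤ K * Real.exp (-(l * r)) := by
  have hG : 0 ≤ Real.Gamma ((m : ℝ) / 2) := Real.Gamma_nonneg_of_nonneg (by positivity)
  set C := (2 ^ (1 - (m : ℝ) / 2) / Real.Gamma ((m : ℝ) / 2)) with hC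
  have hC0 : 0 ≤ C := by positivity
  refine ⟨(C + 1) * ((m - 1).factorial * Real.exp ((l + 1) ^ 2 / 2)), by positivity, ?_⟩
  intro r hr
  have h1 : r ^ (m - 1) ≤ (m - 1).factorial * Real.exp r := by
    have := Real.pow_div_factorial_le_exp r hr (m - 1)
    rw [div_le_iff₀ (by positivity)] at this
    linarith
  have h2 : Real.exp r * Real.exp (-r ^ 2 / 2) ≤
      Real.exp ((l + 1) ^ 2 / 2) * Real.exp (-(l * r)) := by
    rw [← Real.exp_add, ← Real.exp_add, Real.exp_le_exp]
    nlinarith [sq_nonneg (r - (l + 1))]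
  unfold chiPDF
  rw [← hC]
  calc C * r ^ (m - 1) * Real.exp (-r ^ 2 / 2)
      ≤ (C + 1) * ((m - 1).factorial * Real.exp r) * Real.exp (-r ^ 2 / 2) := by
        gcongr; linarith
    _ = (C + 1) * (m - 1).factorial * (Real.exp r * Real.exp (-r ^ 2 / 2)) := by ring
    _ ≤ (C + 1) * (m - 1).factorial *
        (Real.exp ((l + 1) ^ 2 / 2) * Real.exp (-(l * r))) := by gcongr
    _ = _ := by ring

lemma aux_chi_int (m : ℕ) : IntegrableOn (chiPDF m) (Ici 0) := by
  obtain ⟨K, hK, h⟩ := aux_chi_bound m 1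
  have h1 : IntegrableOn (fun r : ℝ => K * Real.exp (-(1 * r))) (Ici 0) := by
    rw [integrableOn_Ici_iff_integrableOn_Ioi]
    have := (integrableOn_exp_neg_Ioi 0).const_mul K
    simpa [IntegrableOn] using this
  refine Integrable.mono' h1 (aux_chi_cont m).aestronglyMeasurable ?_
  filter_upwards [ae_restrict_mem measurableSet_Ici] with r hr
  rw [Real.norm_of_nonneg (aux_chi_nonneg m r hr)]
  exact h r hr

lemma aux_tail (m : ℕ) (l : ℝ) (hl : 0 < l) :
    ∃ K > 0, ∀ ρ, 0 ≤ ρ → ∫ r in Ioi ρ, chiPDF m r ≤ K * Real.exp (-(l * ρ)) := by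
  obtain ⟨K, hK, h⟩ := aux_chi_bound m l
  refine ⟨K / l, by positivity, fun ρ hρ => ?_⟩
  have hi : IntegrableOn (fun r : ℝ => K * Real.exp (-l * r)) (Ioi ρ) :=
    (exp_neg_integrableOn_Ioi ρ hl).const_mul K
  calc ∫ r in Ioi ρ, chiPDF m r ≤ ∫ r in Ioi ρ, K * Real.exp (-l * r) := by
        refine setIntegral_mono_on ((aux_chi_int m).mono_set ?_) hi measurableSet_Ioi ?_
        · intro r hr; exact hρ.trans (le_of_lt hr)
        · intro r hr
          have := h r (hρ.trans (le_of_lt hr))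
          simpa using this
    _ = K / l * Real.exp (-(l * ρ)) := by
        rw [integral_const_mul, integral_exp_mul_Ioi (by linarith)]
        simp; ring

lemma aux_cvx (h : ℝ → ℝ) (hc : ConvexOn ℝ univ h) (t r : ℝ) (ht : 0 ≤ t) (ht1 : t ≤ 1) :
    h (t * r) ≤ (1 - t) * h 0 + t * h r := by
  have := hc.2 (mem_univ 0) (mem_univ r) (sub_nonneg.2 ht1) ht (by ring)
  simpa using this

/-- one-dimensional facts -/
lemma aux_root (h : ℝ → ℝ) (hc : ConvexOn ℝ univ h) (γ ρ : ℝ) (hγ : 0 < γ) (h0 : h 0 < -γ)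
    (hρ : 0 < ρ) (hr : h ρ = 0) (r : ℝ) (hr0 : 0 ≤ r) : h r ≤ 0 ↔ r ≤ ρ := by
  constructor
  · intro hle
    by_contra! hlt
    have hrp : 0 < r := hρ.trans hlt
    have := aux_cvx h hc (ρ / r) r (by positivity)
      (by rw [div_le_one (by linarith)]; exact hlt.le)
    have hrr : ρ / r * r = ρ := by field_simp
    rw [hrr, hr] at this
    have h1 : 0 < 1 - ρ / r := by rw [sub_pos, div_lt_one (by linarith)]; exact hlt
    have h2 : 0 < ρ / r := by positivity
    nlinarith
  · intro hle
    have := aux_cvx h hc (r / ρ) ρ (by positivity)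
      (by rw [div_le_one (by linarith)]; exact hle)
    have hrr : r / ρ * ρ = r := by field_simp
    rw [hrr, hr] at this
    have h1 : 0 ≤ 1 - r / ρ := by rw [sub_nonneg, div_le_one (by linarith)]; exact hle
    nlinarith

lemma aux_slope (h : ℝ → ℝ) (hc : ConvexOn ℝ univ h) (γ ρ : ℝ) (h0 : h 0 < -γ)
    (hρ : 0 < ρ) (hr : h ρ = 0) (d : ℝ) (hd : HasDerivAt h d ρ) : γ / ρ ≤ d := by
  have := hc.slope_le_of_hasDerivAt (mem_univ 0) (mem_univ ρ) hρ hd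
  refine le_trans ?_ this
  rw [slope_def_field, hr, sub_zero]
  gcongr
  linarith

lemma aux_exists (h : ℝ → ℝ) (hcont : Continuous h) (h0 : h 0 < 0) (r : ℝ)
    (hr : 0 ≤ r) (hpos : 0 < h r) : ∃ ρ, 0 < ρ ∧ ρ ≤ r ∧ h ρ = 0 := by
  obtain ⟨ρ, hρ, h1⟩ := intermediate_value_Icc hr hcont.continuousOn ⟨h0.le, hpos.le⟩
  refine ⟨ρ, lt_of_le_of_ne hρ.1 ?_, hρ.2, h1⟩
  rintro rfl
  linarith

/-- convex, nonpositive on the half line: stays below `-γ` -/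
lemma aux_below (γ : ℝ) (h : ℝ → ℝ) (hc : ConvexOn ℝ univ h) (h0 : h 0 ≤ -γ)
    (hle : ∀ r, 0 ≤ r → h r ≤ 0) (r : ℝ) (hr : 0 ≤ r) : h r ≤ -γ := by
  refine le_of_forall_pos_lt_add fun ε hε => ?_
  by_contra! hcon
  have hrpos : 0 < r := by
    rcases hr.eq_or_lt with h | h
    · subst h; linarith
    · exact h
  set δ := h r - h 0 with hδ
  have hδ0 : 0 < δ := by linarith
  -- `h (t r) ≥ h 0 + t δ`
  set t := (|h 0| + δ + 1) / δ with ht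
  have ht1 : 1 < t := by
    rw [ht, lt_div_iff₀ hδ0]; linarith [abs_nonneg (h 0)]
  have := aux_cvx h hc (1 / t) (t * r) (by positivity)
      (by rw [div_le_one (by linarith)]; exact ht1.le)
  have hrr : 1 / t * (t * r) = r := by field_simp
  rw [hrr] at this
  have h2 := hle (t * r) (by positivity)
  have h3 : 0 < 1 / t := by positivity
  have h4 : t * δ = |h 0| + δ + 1 := by rw [ht]; field_simp
  have h5 : δ ≤ 1 / t * (h (t * r) - h 0) := by rw [hδ]; linarith
  have h6 : t * δ ≤ h (t * r) - h 0 := by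
    have := mul_le_mul_of_nonneg_left h5 (by linarith : 0 ≤ t)
    have e : t * (1 / t * (h (t * r) - h 0)) = h (t * r) - h 0 := by field_simp
    linarith
  linarith [neg_abs_le (h 0)]

/-- the truncated integral -/
def auxG {X : Type*} (m : ℕ) (f : X × ℝ → ℝ) (x : X) : ℝ :=
  ∫ r in {r : ℝ | 0 ≤ r ∧ f (x, r) ≤ 0}, chiPDF m r

lemma auxG_eq_of_root {X : Type*} (f : X × ℝ → ℝ) (x : X)
    (hc : ConvexOn ℝ univ (fun r => f (x, r))) (γ ρ : ℝ) (hγ : 0 < γ) (h0 : f (x, 0) < -γ)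
    (hρ : 0 < ρ) (hr : f (x, ρ) = 0) :
    {r : ℝ | 0 ≤ r ∧ f (x, r) ≤ 0} = Icc 0 ρ := by
  ext r
  constructor
  · rintro ⟨h1, h2⟩
    exact ⟨h1, (aux_root _ hc γ ρ hγ h0 hρ hr r h1).1 h2⟩
  · rintro ⟨h1, h2⟩
    exact ⟨h1, (aux_root _ hc γ ρ hγ h0 hρ hr r h1).2 h2⟩

lemma aux_caseA {X : Type*} [NormedAddCommGroup X] [NormedSpace ℝ X] [CompleteSpace X]
    (m : ℕ) (f : X × ℝ → ℝ) (hf : ContDiff ℝ 1 f)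
    (hc : ∀ x, ConvexOn ℝ univ (fun r => f (x, r))) (U : Set X) (hU : IsOpen U)
    (γ : ℝ) (hγ : 0 < γ) (h0 : ∀ x ∈ U, f (x, 0) < -γ) (x : X) (hx : x ∈ U) (ρ : ℝ) (hρ : 0 < ρ)
    (hr : f (x, ρ) = 0) :
    ContDiffAt ℝ 1 (auxG m f) x ∧
      ‖fderiv ℝ (auxG m f) x‖ ≤
        chiPDF m ρ * (ρ / γ) * ‖fderiv ℝ (fun x' => f (x', ρ)) x‖ := by
  have hfd : HasFDerivAt f (fderiv ℝ f (x, ρ)) (x, ρ) :=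
    (hf.differentiable (by norm_num)).differentiableAt.hasFDerivAt
  have h2 : HasDerivAt (fun r => f (x, r)) ((fderiv ℝ f (x, ρ) ∘L .inr ℝ X ℝ) 1) ρ := by
    have := hfd.comp ρ (hasFDerivAt_prodMk_right x ρ)
    exact this.hasDerivAt
  have h1 : HasFDerivAt (fun x' => f (x', ρ)) (fderiv ℝ f (x, ρ) ∘L .inl ℝ X ℝ) x :=
    HasFDerivAt.comp x hfd (hasFDerivAt_prodMk_left x ρ)
  set f2 := fderiv ℝ f (x, ρ) ∘L .inr ℝ X ℝ with hf2
  set f1 := fderiv ℝ f (x, ρ) ∘L .inl ℝ X ℝ with hf1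
  rw [h1.fderiv]
  have hd : γ / ρ ≤ f2 1 := aux_slope _ (hc x) γ ρ (h0 x hx) hρ hr _ h2
  have hdpos : 0 < f2 1 := lt_of_lt_of_le (by positivity) hd
  have hinv : f2.IsInvertible := by
    refine ⟨ContinuousLinearEquiv.unitsEquivAut ℝ (Units.mk0 (f2 1) hdpos.ne'), ?_⟩
    ext
    simp
  have cdf : ContDiffAt ℝ 1 f (x, ρ) := hf.contDiffAt
  set ψ := cdf.implicitFunction one_ne_zero hinv with hψ
  have e1 : ψ x = ρ := cdf.implicitFunction_apply_self one_ne_zero hinv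
  have e2 : ∀ᶠ x' in nhds x, f (x', ψ x') = f (x, ρ) :=
    cdf.eventually_apply_implicitFunction one_ne_zero hinv
  have e3 : HasStrictFDerivAt ψ (-f2.inverse ∘L f1) x :=
    cdf.hasStrictFDerivAt_implicitFunction one_ne_zero hinv
  have e4 : ContDiffAt ℝ 1 ψ x := cdf.contDiffAt_implicitFunction one_ne_zero hinv
  have e5 : ∀ᶠ x' in nhds x, 0 < ψ x' := by
    have := e4.continuousAt
    exact this.eventually (lt_mem_nhds (by rw [e1]; exact hρ))
  have e6 : auxG m f =ᶠ[nhds x] fun x' => ∫ r in (0:ℝ)..ψ x', chiPDF m r := by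
    filter_upwards [e2, e5, hU.mem_nhds hx] with x' k1 k2 k3
    rw [auxG, auxG_eq_of_root f x' (hc x') γ (ψ x') hγ (h0 x' k3) k2 (k1.trans hr),
      integral_Icc_eq_integral_Ioc, intervalIntegral.integral_of_le k2.le]
  have hF : ∀ t, HasDerivAt (fun t => ∫ r in (0:ℝ)..t, chiPDF m r) (chiPDF m t) t := fun t =>
    ((aux_chi_cont m).integral_hasStrictDerivAt 0 t).hasDerivAt
  have hFc : ContDiff ℝ 1 (fun t => ∫ r in (0:ℝ)..t, chiPDF m r) := by
    rw [contDiff_one_iff_deriv]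
    refine ⟨fun t => (hF t).differentiableAt, ?_⟩
    have : deriv (fun t => ∫ r in (0:ℝ)..t, chiPDF m r) = chiPDF m := funext fun t => (hF t).deriv
    rw [this]
    exact aux_chi_cont m
  refine ⟨(hFc.contDiffAt.comp x e4).congr_of_eventuallyEq e6, ?_⟩
  have hD : HasFDerivAt (auxG m f) (chiPDF m ρ • (-f2.inverse ∘L f1)) x := by
    refine HasFDerivAt.congr_of_eventuallyEq ?_ e6
    have := (hF (ψ x)).comp_hasFDerivAt x e3.hasFDerivAt
    rw [e1] at this
    exact this
  rw [hD.fderiv]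
  have hχ := aux_chi_nonneg m ρ hρ.le
  rw [norm_smul, Real.norm_of_nonneg hχ, mul_assoc]
  refine mul_le_mul_of_nonneg_left ?_ hχ
  refine ContinuousLinearMap.opNorm_le_bound _ (by positivity) fun u => ?_
  have k1 : f2 (f2.inverse (f1 u)) = f1 u := hinv.self_apply_inverse _
  set y := f2.inverse (f1 u) with hy
  have k2 : f2 y = y * f2 1 := by
    have := f2.map_smul y 1
    simpa using this
  have k3 : ‖f1 u‖ ≤ ‖f1‖ * ‖u‖ := f1.le_opNorm u
  have k4 : ‖(-f2.inverse ∘L f1) u‖ = ‖y‖ := by simp [hy]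
  rw [k4]
  have k5 : ‖f1 u‖ = ‖y‖ * f2 1 := by
    rw [← k1, k2, norm_mul, Real.norm_of_nonneg hdpos.le]
  have k6 : ‖y‖ * (γ / ρ) ≤ ‖f1‖ * ‖u‖ := by
    calc ‖y‖ * (γ / ρ) ≤ ‖y‖ * f2 1 := by gcongr
      _ ≤ _ := by rw [← k5]; exact k3
  calc ‖y‖ = (ρ / γ) * (‖y‖ * (γ / ρ)) := by field_simp
    _ ≤ (ρ / γ) * (‖f1‖ * ‖u‖) := by gcongr
    _ = _ := by ring

/-- everything for a fixed direction -/
lemma aux_main (m : ℕ) (γ A B : ℝ) (hγ : 0 < γ) (hA : 0 < A) (hB : 0 < B) :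
    ∃ M : ℝ, ∀ (X : Type) [NormedAddCommGroup X] [NormedSpace ℝ X] [CompleteSpace X]
      (f : X × ℝ → ℝ) (_ : ContDiff ℝ 1 f)
      (_ : ∀ x, ConvexOn ℝ univ (fun r => f (x, r))) (U : Set X) (_ : IsOpen U)
      (_ : Convex ℝ U) (_ : ∀ x ∈ U, f (x, 0) < -γ)
      (_ : ∀ x ∈ U, ∀ r, 0 ≤ r → ‖fderiv ℝ (fun x' => f (x', r)) x‖ ≤ A * Real.exp (B * r)),
      (∀ x ∈ U, DifferentiableAt ℝ (auxG m f) x ∧ ‖fderiv ℝ (auxG m f) x‖ ≤ M) ∧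
      ContinuousOn (fderiv ℝ (auxG m f)) U := by
  obtain ⟨K, hK, hKb⟩ := aux_chi_bound m (2 * B + 1)
  obtain ⟨K2, hK2, hKt⟩ := aux_tail m (2 * B) (by positivity)
  refine ⟨K * A / γ, ?_⟩
  intro X _ _ _ f hf hc U hU hUc h0 hgr
  have hcont : ∀ x, Continuous (fun r => f (x, r)) := fun x =>
    hf.continuous.comp (by fun_prop)
  -- bound in the finite case
  have hA' : ∀ x ∈ U, ∀ ρ, 0 < ρ → f (x, ρ) = 0 → ContDiffAt ℝ 1 (auxG m f) x ∧
      ‖fderiv ℝ (auxG m f) x‖ ≤ K * A / γ * Real.exp (-(B * ρ)) := by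
    intro x hx ρ hρ hr
    obtain ⟨a1, a2⟩ := aux_caseA m f hf hc U hU γ hγ h0 x hx ρ hρ hr
    refine ⟨a1, a2.trans ?_⟩
    have hρe : ρ ≤ Real.exp ρ := by linarith [Real.add_one_le_exp ρ]
    calc chiPDF m ρ * (ρ / γ) * ‖fderiv ℝ (fun x' => f (x', ρ)) x‖
        ≤ (K * Real.exp (-((2 * B + 1) * ρ))) * (Real.exp ρ / γ) * (A * Real.exp (B * ρ)) := by
          gcongr
          · exact hKb ρ hρ.le
          · exact hgr x hx ρ hρ.le
      _ = K * A / γ * (Real.exp (-((2 * B + 1) * ρ)) * Real.exp ρ * Real.exp (B * ρ)) := by ring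
      _ = K * A / γ * Real.exp (-(B * ρ)) := by
          rw [← Real.exp_add, ← Real.exp_add]; congr 2; ring
  -- key inequality
  have hkey : ∀ x ∈ U, (∀ r, 0 ≤ r → f (x, r) ≤ 0) → ∀ x' ∈ U, ∀ ρ, 0 < ρ → f (x', ρ) = 0 →
      Real.exp (-(B * ρ)) ≤ A / γ * ‖x' - x‖ := by
    intro x hx hle x' hx' ρ hρ hr
    have b1 : f (x, ρ) ≤ -γ := aux_below γ _ (hc x) (h0 x hx).le hle ρ hρ.le
    have hdiff : Differentiable ℝ (fun x' => f (x', ρ)) :=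
      (hf.differentiable (by norm_num)).comp (by fun_prop)
    have b2 := hUc.norm_image_sub_le_of_norm_fderiv_le (𝕜 := ℝ) (f := fun x' => f (x', ρ))
      (fun y _ => hdiff y) (fun y hy => hgr y hy ρ hρ.le) hx hx'
    simp only [hr] at b2
    have b3 : γ ≤ A * Real.exp (B * ρ) * ‖x' - x‖ := by
      refine le_trans ?_ b2
      rw [Real.norm_eq_abs]
      exact le_trans (by linarith) (le_abs_self _)
    have b4 : Real.exp (B * ρ) * Real.exp (-(B * ρ)) = 1 := by
      rw [← Real.exp_add]; simp
    rw [div_mul_eq_mul_div, le_div_iff₀ hγ]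
    calc Real.exp (-(B * ρ)) * γ ≤ Real.exp (-(B * ρ)) * (A * Real.exp (B * ρ) * ‖x' - x‖) := by
          gcongr
      _ = A * ‖x' - x‖ * (Real.exp (B * ρ) * Real.exp (-(B * ρ))) := by ring
      _ = A * ‖x' - x‖ := by rw [b4, mul_one]
  -- alternatives
  have halt : ∀ x ∈ U, (∀ r, 0 ≤ r → f (x, r) ≤ 0) ∨ ∃ ρ, 0 < ρ ∧ f (x, ρ) = 0 := by
    intro x hx
    by_cases h : ∀ r, 0 ≤ r → f (x, r) ≤ 0
    · exact Or.inl h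
    · push Not at h
      obtain ⟨r, hr, hp⟩ := h
      obtain ⟨ρ, a, _, b⟩ := aux_exists _ (hcont x) (by have := h0 x hx; linarith) r hr hp
      exact Or.inr ⟨ρ, a, b⟩
  have hGinf : ∀ x, (∀ r, 0 ≤ r → f (x, r) ≤ 0) → auxG m f x = ∫ r in Ici 0, chiPDF m r := by
    intro x hx
    rw [auxG]
    congr 2
    ext r
    exact ⟨fun h => h.1, fun h => ⟨h, hx r h⟩⟩
  have hB' : ∀ x ∈ U, (∀ r, 0 ≤ r → f (x, r) ≤ 0) → HasFDerivAt (auxG m f) (0 : X →L[ℝ] ℝ) x := by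
    intro x hx hle
    have hO : (fun x' => auxG m f x' - auxG m f x) =O[nhds x] fun x' => ‖x' - x‖ ^ 2 := by
      refine Asymptotics.IsBigO.of_bound (K2 * (A / γ) ^ 2) ?_
      filter_upwards [hU.mem_nhds hx] with x' hx'
      rcases halt x' hx' with h | ⟨ρ, hρ, hr⟩
      · rw [hGinf x hle, hGinf x' h]; simp; positivity
      · have c1 : auxG m f x' = ∫ r in Icc 0 ρ, chiPDF m r := by
          rw [auxG, auxG_eq_of_root f x' (hc x') γ ρ hγ (h0 x' hx') hρ hr]
        have c2 : ∫ r in Ici 0, chiPDF m r =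
            (∫ r in Icc 0 ρ, chiPDF m r) + ∫ r in Ioi ρ, chiPDF m r := by
          rw [← Icc_union_Ioi_eq_Ici hρ.le]
          refine setIntegral_union ?_ measurableSet_Ioi ?_ ?_
          · exact Set.disjoint_left.2 fun r h1 h2 => absurd h1.2 (not_le.2 h2)
          · exact (aux_chi_int m).mono_set Icc_subset_Ici_self
          · exact (aux_chi_int m).mono_set fun r h => hρ.le.trans (le_of_lt h)
        have c3 : 0 ≤ ∫ r in Ioi ρ, chiPDF m r :=
          setIntegral_nonneg measurableSet_Ioi fun r h =>
            aux_chi_nonneg m r (hρ.le.trans (le_of_lt h))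
        rw [hGinf x hle, c1, c2]
        have c4 := hKt ρ hρ.le
        have c5 := hkey x hx hle x' hx' ρ hρ hr
        have c6 : Real.exp (-(2 * B * ρ)) = Real.exp (-(B * ρ)) ^ 2 := by
          rw [← Real.exp_nat_mul]; congr 1; push_cast; ring
        rw [sub_add_cancel_left, norm_neg, Real.norm_of_nonneg c3, norm_pow, norm_norm]
        calc _ ≤ _ := c4
          _ ≤ K2 * (A / γ * ‖x' - x‖) ^ 2 := by rw [c6]; gcongr
          _ = _ := by ring
    have := hO.hasFDerivAt (𝕜 := ℝ) (by norm_num)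
    have h3 := this.add_const (auxG m f x)
    simpa using h3
  refine ⟨?_, ?_⟩
  · intro x hx
    rcases halt x hx with h | ⟨ρ, hρ, hr⟩
    · refine ⟨(hB' x hx h).differentiableAt, ?_⟩
      rw [(hB' x hx h).fderiv, norm_zero]; positivity
    · obtain ⟨a1, a2⟩ := hA' x hx ρ hρ hr
      refine ⟨a1.differentiableAt (by norm_num), a2.trans ?_⟩
      have : Real.exp (-(B * ρ)) ≤ 1 := Real.exp_le_one_iff.2 (by
        have : 0 < B * ρ := by positivity
        linarith)
      calc _ ≤ K * A / γ * 1 := by gcongr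
        _ = _ := mul_one _
  · intro x hx
    refine ContinuousAt.continuousWithinAt ?_
    rcases halt x hx with h | ⟨ρ, hρ, hr⟩
    · rw [ContinuousAt, (hB' x hx h).fderiv, tendsto_zero_iff_norm_tendsto_zero]
      have hlim : Filter.Tendsto (fun x' => K * A / γ * (A / γ * ‖x' - x‖)) (nhds x) (nhds 0) := by
        have : Continuous (fun x' => K * A / γ * (A / γ * ‖x' - x‖)) := by fun_prop
        have := this.tendsto x
        simpa using this
      refine squeeze_zero' (Filter.Eventually.of_forall fun _ => norm_nonneg _) ?_ hlim
      filter_upwards [hU.mem_nhds hx] with x' hx'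
      rcases halt x' hx' with h' | ⟨ρ, hρ, hr⟩
      · rw [(hB' x' hx' h').fderiv, norm_zero]; positivity
      · refine (hA' x' hx' ρ hρ hr).2.trans ?_
        gcongr
        exact hkey x hx h x' hx' ρ hρ hr
    · exact (hA' x hx ρ hρ hr).1.continuousAt_fderiv (by norm_num)

lemma auxG_abs_le {X : Type*} (m : ℕ) (f : X × ℝ → ℝ) (x : X) :
    ‖auxG m f x‖ ≤ ∫ r in Ici 0, chiPDF m r := by
  have hsub : {r : ℝ | 0 ≤ r ∧ f (x, r) ≤ 0} ⊆ Ici 0 := fun r h => h.1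
  have hae : 0 ≤ᵐ[volume.restrict (Ici 0)] chiPDF m := by
    filter_upwards [ae_restrict_mem measurableSet_Ici] with r hr
    exact aux_chi_nonneg m r hr
  rw [auxG, Real.norm_of_nonneg]
  · exact setIntegral_mono_set (aux_chi_int m) hae hsub.eventuallyLE
  · exact integral_nonneg_of_ae (ae_mono (Measure.restrict_mono hsub le_rfl) hae)

lemma auxG_meas {X Q : Type*} [MeasurableSpace Q] (m : ℕ) (f : Q → X × ℝ → ℝ) (x : X)
    (hf : Measurable fun q : Q × ℝ => f q.1 (x, q.2)) :
    StronglyMeasurable fun q => auxG m (f q) x := by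
  have hset : MeasurableSet {q : Q × ℝ | 0 ≤ q.2 ∧ f q.1 (x, q.2) ≤ 0} :=
    (measurableSet_le measurable_const measurable_snd).inter
      (measurableSet_le hf measurable_const)
  have h1 : StronglyMeasurable
      ({q : Q × ℝ | 0 ≤ q.2 ∧ f q.1 (x, q.2) ≤ 0}.indicator fun q => chiPDF m q.2) := by
    refine StronglyMeasurable.indicator ?_ hset
    exact ((aux_chi_cont m).measurable.comp measurable_snd).stronglyMeasurable
  have h2 := h1.integral_prod_right' (ν := volume)
  convert h2 using 2 with q
  have hq : MeasurableSet {r : ℝ | 0 ≤ r ∧ f q (x, r) ≤ 0} :=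
    hset.preimage (measurable_const.prodMk measurable_id : Measurable fun r : ℝ => (q, r))
  rw [auxG, ← integral_indicator hq]
  rfl

lemma aux_fderiv_meas {n : ℕ} {Q : Type*} [MeasurableSpace Q]
    (F : Q → EuclideanSpace ℝ (Fin n) → ℝ) (hF : ∀ x, StronglyMeasurable fun q => F q x)
    (x : EuclideanSpace ℝ (Fin n)) (hd : ∀ q, DifferentiableAt ℝ (F q) x) :
    StronglyMeasurable fun q => fderiv ℝ (F q) x := by
  have h1 : ∀ v, StronglyMeasurable fun q => fderiv ℝ (F q) x v := by
    intro v
    refine stronglyMeasurable_of_tendsto (u := Filter.atTop)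
      (f := fun (k : ℕ) q => (k : ℝ) • (F q (x + (k : ℝ)⁻¹ • v) - F q x)) ?_ ?_
    · intro k
      exact ((hF _).sub (hF _)).const_smul (k : ℝ)
    · rw [tendsto_pi_nhds]
      intro q
      refine (hd q).hasFDerivAt.lim v (c := fun k : ℕ => (k : ℝ)) ?_
      simpa using tendsto_natCast_atTop_atTop (R := ℝ)
  have h2 : (fun q => fderiv ℝ (F q) x) = fun q => ∑ i : Fin n,
      (fderiv ℝ (F q) x (EuclideanSpace.single i 1)) •
        (EuclideanSpace.proj i : EuclideanSpace ℝ (Fin n) →L[ℝ] ℝ) := by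
    funext q
    ext v
    have hv : v = ∑ i, v i • EuclideanSpace.single i (1:ℝ) := by
      ext j
      simp [Pi.single_apply]
    conv_lhs => rw [hv]
    simp [map_sum, mul_comm]
  rw [h2]
  refine Finset.stronglyMeasurable_fun_sum _ fun i _ => ?_
  exact (h1 _).smul_const _

lemma aux_mApp_meas {m : ℕ} {Q : Type*} [MeasurableSpace Q]
    (A : Q → Matrix (Fin m) (Fin m) ℝ) (v : Q → EuclideanSpace ℝ (Fin m))
    (hA : ∀ i j, Measurable fun q => A q i j) (hv : Measurable v) :
    Measurable fun q => mApp (A q) (v q) := by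
  have : (fun q => mApp (A q) (v q)) = fun q => WithLp.toLp 2 (fun i => ∑ j, A q i j * v q j) := by
    funext q
    ext i
    simp [mApp, Matrix.mulVec, dotProduct]
  rw [this]
  refine (PiLp.continuous_toLp 2 _).measurable.comp ?_
  refine measurable_pi_lambda _ fun i => Finset.measurable_sum _ fun j _ => ?_
  refine (hA i j).mul ?_
  exact ((EuclideanSpace.proj j : EuclideanSpace ℝ (Fin m) →L[ℝ] ℝ).continuous.measurable).comp hv

lemma aux_sphere_finite (m : ℕ) : IsFiniteMeasure (unifSphere m) := by
  constructor
  unfold unifSphere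
  rw [Measure.smul_apply, smul_eq_mul]
  by_cases h : ((volume : Measure (EuclideanSpace ℝ (Fin m))).toSphere) Set.univ = 0
  · rw [h, mul_zero]; simp
  · rw [ENNReal.inv_mul_cancel h (measure_ne_top _ _)]; simp

/-- near a 𝔷-uniform Slater point where `g` has exponential
growth, the probability function `Φ(x) = ∫ e_c(x, v) d(ζ ⊗ 𝔪)(v, c)` is
continuously differentiable with `∇Φ(x) = ∫ ∇_x e_c(x, v) d(ζ ⊗ 𝔪)(v, c)`. -/
theorem probFun_contDiff_gradient
    {n m p : ℕ} (hn : 0 < n) (hm : 0 < m) (hp : 0 < p)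
    (𝒞 : Set (EuclideanSpace ℝ (Fin p))) (h𝒞 : MeasurableSet 𝒞)
    (z : EuclideanSpace ℝ (Fin p) → EuclideanSpace ℝ (Fin m))
    (L : EuclideanSpace ℝ (Fin p) → Matrix (Fin m) (Fin m) ℝ)
    (hz : Measurable fun c : 𝒞 => z c)
    (hL : ∀ i j, Measurable fun c : 𝒞 => L c i j)
    (g : EuclideanSpace ℝ (Fin n) → EuclideanSpace ℝ (Fin m) → ℝ)
    (𝔪 : Measure 𝒞) [IsProbabilityMeasure 𝔪]
    (η₀ : ℝ) (hη₀ : 0 < η₀)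
    (hη : ∀ c ∈ 𝒞, ‖z c‖ + ‖Matrix.toEuclideanCLM (𝕜 := ℝ) (L c)‖ ≤ η₀)
    (hg : ContDiff ℝ 1 (Function.uncurry g))
    (hconv : ∀ x, ConvexOn ℝ Set.univ (g x))
    (xbar : EuclideanSpace ℝ (Fin n))
    (hSlater : ∃ U : Set (EuclideanSpace ℝ (Fin n)), IsOpen U ∧ xbar ∈ U ∧
      ∃ γ₀ > 0, ∀ x ∈ U, ∀ c ∈ 𝒞, g x (z c) < -γ₀)
    (hgrowth : ∃ ε > (0:ℝ), ∃ a > (0:ℝ), ∃ b > (0:ℝ), ∀ x ∈ Metric.ball xbar ε,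
      ∀ w : EuclideanSpace ℝ (Fin m), ‖gradient (fun x' => g x' w) x‖ ≤ a * Real.exp (b * ‖w‖)) :
    ∃ U' : Set (EuclideanSpace ℝ (Fin n)), IsOpen U' ∧ xbar ∈ U' ∧
      ContDiffOn ℝ 1 (fun y => ∫ q : Metric.sphere (0 : EuclideanSpace ℝ (Fin m)) 1 × 𝒞, radialE g z L (↑q.2) y (↑q.1) ∂((unifSphere m).prod 𝔪)) U' ∧
      ∀ x ∈ U',
        gradient (fun y => ∫ q : Metric.sphere (0 : EuclideanSpace ℝ (Fin m)) 1 × 𝒞, radialE g z L (↑q.2) y (↑q.1) ∂((unifSphere m).prod 𝔪)) x =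
          ∫ q : Metric.sphere (0 : EuclideanSpace ℝ (Fin m)) 1 × 𝒞,
            gradient (fun x' => radialE g z L (↑q.2) x' (↑q.1)) x
            ∂((unifSphere m).prod 𝔪) := by
  obtain ⟨U₁, hU₁, hxU₁, γ, hγ, hS⟩ := hSlater
  obtain ⟨ε, hε, a, ha, b, hb, hG⟩ := hgrowth
  obtain ⟨δ, hδ, hδU⟩ := Metric.isOpen_iff.1 (hU₁.inter (Metric.isOpen_ball (x := xbar) (ε := ε)))
    xbar ⟨hxU₁, Metric.mem_ball_self hε⟩
  set U := Metric.ball xbar δ with hU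
  have := aux_sphere_finite m
  set f : Metric.sphere (0 : EuclideanSpace ℝ (Fin m)) 1 × 𝒞 →
      EuclideanSpace ℝ (Fin n) × ℝ → ℝ :=
    fun q y => g y.1 (y.2 • mApp (L q.2) q.1 + z q.2) with hfdef
  have hGf : ∀ q : Metric.sphere (0 : EuclideanSpace ℝ (Fin m)) 1 × 𝒞,
      (fun y => radialE g z L (↑q.2) y (↑q.1)) = auxG m (f q) := fun q => rfl
  have hGf' : ∀ (q : Metric.sphere (0 : EuclideanSpace ℝ (Fin m)) 1 × 𝒞) y,
      radialE g z L (↑q.2) y (↑q.1) = auxG m (f q) y := fun q y => rfl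
  simp only [hGf']
  obtain ⟨M, hM⟩ := aux_main m γ (a * Real.exp (b * η₀)) (b * η₀) hγ (by positivity)
    (by positivity)
  have hmain : ∀ q, (∀ x ∈ U, DifferentiableAt ℝ (auxG m (f q)) x ∧
      ‖fderiv ℝ (auxG m (f q)) x‖ ≤ M) ∧ ContinuousOn (fderiv ℝ (auxG m (f q))) U := by
    intro q
    refine hM (EuclideanSpace ℝ (Fin n)) (f q) ?_ ?_ U Metric.isOpen_ball (convex_ball _ _) ?_ ?_
    · exact hg.comp (g := Function.uncurry g)
        (f := fun y : EuclideanSpace ℝ (Fin n) × ℝ => (y.1, y.2 • mApp (L q.2) q.1 + z q.2))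
        (by fun_prop)
    · intro x
      refine ⟨convex_univ, fun r _ s _ α β hα hβ hαβ => ?_⟩
      have := (hconv x).2 (mem_univ (r • mApp (L q.2) q.1 + z q.2))
        (mem_univ (s • mApp (L q.2) q.1 + z q.2)) hα hβ hαβ
      have e : (α • r + β • s) • mApp (L q.2) q.1 + z q.2 =
          α • (r • mApp (L q.2) q.1 + z q.2) + β • (s • mApp (L q.2) q.1 + z q.2) := by
        have : z q.2 = (α + β) • z q.2 := by rw [hαβ, one_smul]
        nth_rewrite 1 [this]
        simp only [smul_eq_mul]
        module
      simp only [hfdef]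
      rw [e]
      exact this
    · intro x hx
      simpa [hfdef] using hS x (hδU hx).1 q.2 q.2.2
    · intro x hx r hr
      have h1 := hG x (hδU hx).2 (r • mApp (L q.2) q.1 + z q.2)
      rw [gradient, LinearIsometryEquiv.norm_map] at h1
      refine h1.trans ?_
      rw [mul_assoc, ← Real.exp_add]
      have h2 : ‖mApp (L q.2) q.1‖ ≤ ‖Matrix.toEuclideanCLM (𝕜 := ℝ) (L q.2)‖ := by
        have := (Matrix.toEuclideanCLM (𝕜 := ℝ) (L q.2)).le_opNorm
          (q.1 : EuclideanSpace ℝ (Fin m))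
        have hv : ‖(q.1 : EuclideanSpace ℝ (Fin m))‖ = 1 := by simp
        rw [hv, mul_one] at this
        exact this
      have h3 := hη q.2 q.2.2
      have h4 : ‖r • mApp (L q.2) q.1 + z q.2‖ ≤ r * η₀ + η₀ := by
        refine (norm_add_le _ _).trans ?_
        rw [norm_smul, Real.norm_of_nonneg hr]
        have : ‖mApp (L q.2) q.1‖ ≤ η₀ := by linarith [norm_nonneg (z q.2)]
        have h5 : ‖z q.2‖ ≤ η₀ := by
          linarith [norm_nonneg (Matrix.toEuclideanCLM (𝕜 := ℝ) (L q.2))]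
        gcongr
      have h6 : b * ‖r • mApp (L q.2) q.1 + z q.2‖ ≤ b * η₀ + b * η₀ * r := by
        calc _ ≤ b * (r * η₀ + η₀) := by gcongr
          _ = _ := by ring
      gcongr
  have hmeas : ∀ x, StronglyMeasurable fun q => auxG m (f q) x := by
    intro x
    refine auxG_meas m f x ?_
    have hgx : Measurable (g x) :=
      (hg.continuous.comp (by fun_prop : Continuous fun w => (x, w))).measurable
    refine hgx.comp ?_
    refine (measurable_snd.smul ?_).add ?_
    · exact aux_mApp_meas _ _ (fun i j => (hL i j).comp (measurable_snd.comp measurable_fst))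
        (measurable_subtype_coe.comp (measurable_fst.comp measurable_fst))
    · exact hz.comp (measurable_snd.comp measurable_fst)
  have hmeas' : ∀ x ∈ U, StronglyMeasurable fun q => fderiv ℝ (auxG m (f q)) x := fun x hx =>
    aux_fderiv_meas (fun q => auxG m (f q)) hmeas x fun q => ((hmain q).1 x hx).1
  have hint : ∀ x, Integrable (fun q => auxG m (f q) x) ((unifSphere m).prod 𝔪) := fun x =>
    Integrable.of_bound (hmeas x).aestronglyMeasurable (∫ r in Ici 0, chiPDF m r)
      (Filter.Eventually.of_forall fun q => auxG_abs_le m (f q) x)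
  have hint' : ∀ x ∈ U, Integrable (fun q => fderiv ℝ (auxG m (f q)) x)
      ((unifSphere m).prod 𝔪) := fun x hx =>
    Integrable.of_bound (hmeas' x hx).aestronglyMeasurable M
      (Filter.Eventually.of_forall fun q => ((hmain q).1 x hx).2)
  have hder : ∀ x ∈ U, HasFDerivAt (fun y => ∫ q, auxG m (f q) y ∂((unifSphere m).prod 𝔪))
      (∫ q, fderiv ℝ (auxG m (f q)) x ∂((unifSphere m).prod 𝔪)) x := by
    intro x hx
    refine hasFDerivAt_integral_of_dominated_of_fderiv_le (𝕜 := ℝ) (s := U)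
      (F := fun y q => auxG m (f q) y) (F' := fun y q => fderiv ℝ (auxG m (f q)) y)
      (bound := fun _ => M)
      (Metric.isOpen_ball.mem_nhds hx)
      (Filter.Eventually.of_forall fun y => (hmeas y).aestronglyMeasurable) (hint x)
      (hmeas' x hx).aestronglyMeasurable ?_ (integrable_const _) ?_
    · exact Filter.Eventually.of_forall fun q y hy => ((hmain q).1 y hy).2
    · exact Filter.Eventually.of_forall fun q y hy => ((hmain q).1 y hy).1.hasFDerivAt
  refine ⟨U, Metric.isOpen_ball, Metric.mem_ball_self hδ, ?_, ?_⟩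
  · have := (contDiffOn_succ_iff_fderiv_of_isOpen (𝕜 := ℝ) (n := 0) (s := U)
      (f := fun y => ∫ q, auxG m (f q) y ∂((unifSphere m).prod 𝔪)) Metric.isOpen_ball).2
    rw [zero_add] at this
    refine this ⟨fun x hx => (hder x hx).differentiableAt.differentiableWithinAt, by simp, ?_⟩
    rw [contDiffOn_zero]
    have hc : ContinuousOn (fun x => ∫ q, fderiv ℝ (auxG m (f q)) x ∂((unifSphere m).prod 𝔪)) U :=
      continuousOn_of_dominated (bound := fun _ => M)
        (fun x hx => (hmeas' x hx).aestronglyMeasurable)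
        (fun x hx => Filter.Eventually.of_forall fun q => ((hmain q).1 x hx).2)
        (integrable_const _) (Filter.Eventually.of_forall fun q => (hmain q).2)
    exact hc.congr fun x hx => (hder x hx).fderiv
  · intro x hx
    have hgi : Integrable (fun q => gradient (auxG m (f q)) x) ((unifSphere m).prod 𝔪) := by
      refine Integrable.of_bound (C := M) ?_ ?_
      · exact ((InnerProductSpace.toDual ℝ (EuclideanSpace ℝ (Fin n))).symm.continuous.comp_stronglyMeasurable
          (hmeas' x hx)).aestronglyMeasurable
      · refine Filter.Eventually.of_forall fun q => ?_
        rw [gradient, LinearIsometryEquiv.norm_map]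
        exact ((hmain q).1 x hx).2
    refine ext_inner_left ℝ fun u => ?_
    have e1 : inner ℝ u (∫ q, gradient (auxG m (f q)) x ∂((unifSphere m).prod 𝔪)) =
        ∫ q, inner ℝ u (gradient (auxG m (f q)) x) ∂((unifSphere m).prod 𝔪) :=
      (integral_inner hgi u).symm
    have e2 : ∀ h : EuclideanSpace ℝ (Fin n) → ℝ, inner ℝ u (gradient h x) = fderiv ℝ h x u := by
      intro h
      rw [real_inner_comm, gradient, InnerProductSpace.toDual_symm_apply]
    refine Eq.trans ?_ e1.symm
    simp only [e2]
    rw [(hder x hx).fderiv, ContinuousLinearMap.integral_apply (hint' x hx)]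

end
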